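/- Let H be a finite dimensional Hopf algebra over k with antipode S, λ a right integral on H, Λ a left cointegral with λ(Λ)=1, and α_H the distinguished grouplike of H*. Then for any x ∈ H and any left H-module M with m ∈ M: α_H(x₍₂₎) λ(S(x₍₁₎) Λ₍₁₎ x₍₃₎) (S⁻¹(Λ₍₂₎)·m) ⊗ x₍₄₎ = m ⊗ x in M ⊗ H. -/

import Mathlib

open Coalgebra TensorProduct

section Helpers

variable {k H N : Type*} [Field k] [Ring H] [HopfAlgebra k H] [AddCommGroup N] [Module k N]

theorem aux_counit_left (f : H ⊗[k] H →ₗ[k] N) (g : H →ₗ[k] N)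
    (h : ∀ a b, f (a ⊗ₜ b) = counit (R := k) a • g b) (x : H) :
    f (comul (R := k) x) = g x := by
  have e : f = g ∘ₗ (TensorProduct.lid k H).toLinearMap ∘ₗ
      (counit (R := k) (A := H)).rTensor H := by
    ext a b; simp [h]
  rw [e]; simp

theorem aux_counit_right (f : H ⊗[k] H →ₗ[k] N) (g : H →ₗ[k] N)
    (h : ∀ a b, f (a ⊗ₜ b) = counit (R := k) b • g a) (x : H) :
    f (comul (R := k) x) = g x := by
  have e : f = g ∘ₗ (TensorProduct.rid k H).toLinearMap ∘ₗ
      (counit (R := k) (A := H)).lTensor H := by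
    ext a b; simp [h]
  rw [e]; simp

theorem aux_coassoc (f : H ⊗[k] (H ⊗[k] H) →ₗ[k] N) (f1 f2 : H ⊗[k] H →ₗ[k] N)
    (h1 : ∀ a b, f (a ⊗ₜ comul (R := k) b) = f1 (a ⊗ₜ b))
    (h2 : ∀ a b, f (TensorProduct.assoc k H H H (comul (R := k) a ⊗ₜ b)) = f2 (a ⊗ₜ b))
    (x : H) : f1 (comul (R := k) x) = f2 (comul (R := k) x) := by
  have e1 : f1 = f ∘ₗ (comul (R := k)).lTensor H := by
    ext a b; simp [h1]
  have e2 : f2 = f ∘ₗ (TensorProduct.assoc k H H H).toLinearMap ∘ₗ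
      (comul (R := k)).rTensor H := by
    ext a b; simp [h2]
  rw [e1, e2]
  simp only [LinearMap.comp_apply, LinearEquiv.coe_coe, Coalgebra.coassoc_apply]

/-- Step A: `S(x) Λ₁ ⊗ Λ₂ = Λ₁ ⊗ x Λ₂`. -/
theorem aux_stepA (Λ : H) (hΛ : ∀ h : H, h * Λ = counit (R := k) h • Λ) (x : H) :
    (HopfAlgebra.antipode k x ⊗ₜ[k] (1 : H)) * comul (R := k) Λ =
      ((1 : H) ⊗ₜ[k] x) * comul (R := k) Λ := by
  let D : H ⊗[k] H := comul (R := k) Λ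
  let R : H ⊗[k] H →ₗ[k] H ⊗[k] H := LinearMap.mulRight k D
  let g1 : H →ₗ[k] H ⊗[k] H :=
    R ∘ₗ (TensorProduct.mk k H H).flip 1 ∘ₗ HopfAlgebra.antipode k
  let g2 : H →ₗ[k] H ⊗[k] H := R ∘ₗ TensorProduct.mk k H H 1
  let f : H ⊗[k] (H ⊗[k] H) →ₗ[k] H ⊗[k] H :=
    R ∘ₗ TensorProduct.lift ((LinearMap.mul k (H ⊗[k] H)) ∘ₗ
      (TensorProduct.mk k H H).flip 1 ∘ₗ HopfAlgebra.antipode k)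
  let f1 : H ⊗[k] H →ₗ[k] H ⊗[k] H :=
    g1 ∘ₗ (TensorProduct.rid k H).toLinearMap ∘ₗ (counit (R := k) (A := H)).lTensor H
  let f2 : H ⊗[k] H →ₗ[k] H ⊗[k] H :=
    g2 ∘ₗ (TensorProduct.lid k H).toLinearMap ∘ₗ (counit (R := k) (A := H)).rTensor H
  have key := aux_coassoc f f1 f2 ?_ ?_ x
  · have a1 : f1 (comul (R := k) x) = g1 x := by simp [f1]
    have a2 : f2 (comul (R := k) x) = g2 x := by simp [f2]
    rw [a1, a2] at key
    simpa [g1, g2, R, D] using key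
  · intro a b
    have : comul (R := k) b * D = counit (R := k) b • D := by
      simp only [D]; rw [← Bialgebra.comul_mul, hΛ, map_smul]
    simp [f, f1, g1, R, mul_assoc, this]
  · intro a b
    have gen : ∀ u : H ⊗[k] H, f (TensorProduct.assoc k H H H (u ⊗ₜ b)) =
        ((LinearMap.mul' k H ((HopfAlgebra.antipode k).rTensor H u)) ⊗ₜ[k] b) * D := by
      intro u
      induction u with
      | zero => simp
      | tmul p q => simp [f, R]
      | add p q hp hq => simp only [TensorProduct.add_tmul, map_add, hp, hq, add_mul]
    rw [gen]
    simp [f2, g2, R, Algebra.algebraMap_eq_smul_one, TensorProduct.smul_tmul']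

/-- Step B: `Λ₁ x ⊗ Λ₂ = α(x₁) Λ₁ ⊗ Λ₂ S(x₂)`. -/
theorem aux_stepB (Λ : H) (α : H →ₗ[k] k) (hα : ∀ h : H, Λ * h = α h • Λ) (x : H) :
    comul (R := k) Λ * (x ⊗ₜ[k] (1 : H)) =
      comul (R := k) Λ * ((1 : H) ⊗ₜ[k] HopfAlgebra.antipode k
        (TensorProduct.lid k H (α.rTensor H (comul (R := k) x)))) := by
  let D : H ⊗[k] H := comul (R := k) Λ
  let L : H ⊗[k] H →ₗ[k] H ⊗[k] H := LinearMap.mulLeft k D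
  let g1 : H →ₗ[k] H ⊗[k] H := L ∘ₗ (TensorProduct.mk k H H).flip 1
  let g2 : H →ₗ[k] H ⊗[k] H := L ∘ₗ TensorProduct.mk k H H 1 ∘ₗ HopfAlgebra.antipode k
  let f : H ⊗[k] (H ⊗[k] H) →ₗ[k] H ⊗[k] H :=
    L ∘ₗ (LinearMap.mul' k H ∘ₗ (HopfAlgebra.antipode k).lTensor H).lTensor H
  let f1 : H ⊗[k] H →ₗ[k] H ⊗[k] H :=
    g1 ∘ₗ (TensorProduct.rid k H).toLinearMap ∘ₗ (counit (R := k) (A := H)).lTensor H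
  let f2 : H ⊗[k] H →ₗ[k] H ⊗[k] H :=
    g2 ∘ₗ (TensorProduct.lid k H).toLinearMap ∘ₗ α.rTensor H
  have key := aux_coassoc f f1 f2 ?_ ?_ x
  · have a1 : f1 (comul (R := k) x) = g1 x := by simp [f1]
    rw [a1] at key
    simpa [g1, g2, f2, L, D] using key
  · intro a b
    simp [f, f1, g1, L, Algebra.algebraMap_eq_smul_one]
  · intro a b
    have gen : ∀ u : H ⊗[k] H, f (TensorProduct.assoc k H H H (u ⊗ₜ b)) =
        D * u * ((1 : H) ⊗ₜ[k] HopfAlgebra.antipode k b) := by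
      intro u
      induction u with
      | zero => simp
      | tmul p q => simp [f, L, mul_assoc]
      | add p q hp hq => simp only [TensorProduct.add_tmul, map_add, hp, hq, add_mul, mul_add]
    have : D * comul (R := k) a = α a • D := by
      simp only [D]; rw [← Bialgebra.comul_mul, hα, map_smul]
    rw [gen, this]
    simp [f2, g2, L]

/-- `αS(y₁) α(y₂) y₃ = y`. -/
theorem aux_stepC (α β : H →ₗ[k] k) (h1 : α 1 = 1) (hm : ∀ a b, α (a * b) = α a * α b)
    (hβ : ∀ a, β a = α (HopfAlgebra.antipode k a)) (y : H) :
    TensorProduct.lid k H (TensorProduct.map β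
      ((TensorProduct.lid k H).toLinearMap ∘ₗ α.rTensor H ∘ₗ comul (R := k))
      (comul (R := k) y)) = y := by
  let f : H ⊗[k] (H ⊗[k] H) →ₗ[k] H :=
    (TensorProduct.lid k H).toLinearMap ∘ₗ TensorProduct.map β
      ((TensorProduct.lid k H).toLinearMap ∘ₗ α.rTensor H)
  let f1 : H ⊗[k] H →ₗ[k] H := (TensorProduct.lid k H).toLinearMap ∘ₗ TensorProduct.map β
      ((TensorProduct.lid k H).toLinearMap ∘ₗ α.rTensor H ∘ₗ comul (R := k))
  let f2 : H ⊗[k] H →ₗ[k] H :=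
    (TensorProduct.lid k H).toLinearMap ∘ₗ (counit (R := k) (A := H)).rTensor H
  have key := aux_coassoc f f1 f2 ?_ ?_ y
  · have a2 : f2 (comul (R := k) y) = y := by simp [f2]
    rw [a2] at key
    exact key
  · intro a b
    simp [f, f1]
  · intro a b
    have gen : ∀ u : H ⊗[k] H, f (TensorProduct.assoc k H H H (u ⊗ₜ b)) =
        α (LinearMap.mul' k H ((HopfAlgebra.antipode k).rTensor H u)) • b := by
      intro u
      induction u with
      | zero => simp
      | tmul p q => simp [f, hm, hβ, smul_smul, mul_comm]
      | add p q hp hq => simp only [TensorProduct.add_tmul, map_add, hp, hq, add_smul]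
    rw [gen]
    simp [f2, Algebra.algebraMap_eq_smul_one, h1]

end Helpers

/-- Let `H` be a finite dimensional Hopf algebra over `k` with antipode
`S` (with inverse `Sinv`), `λ` a right integral on `H`, `Λ` a left cointegral with
`λ(Λ) = 1`, and `αH` the distinguished grouplike of `H*`.  Then for any `x ∈ H` and any
left `H`-module `M` with `m ∈ M`:
`αH(x₍₂₎) λ(S(x₍₁₎) Λ₍₁₎ x₍₃₎) (S⁻¹(Λ₍₂₎)·m) ⊗ x₍₄₎ = m ⊗ x` in `M ⊗ H`
(stated for all representations of the iterated coproduct of `x` and of `Δ Λ`). -/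
theorem chromatic_evaluation_identity
    {k H M : Type*} [Field k] [Ring H] [HopfAlgebra k H] [FiniteDimensional k H]
    [AddCommGroup M] [Module k M] [Module H M] [IsScalarTower k H M]
    (Sinv : H →ₗ[k] H)
    (hS1 : ∀ x : H, HopfAlgebra.antipode (R := k) (Sinv x) = x)
    (hS2 : ∀ x : H, Sinv (HopfAlgebra.antipode (R := k) x) = x)
    (Λ : H) (hΛ0 : Λ ≠ 0)
    (hΛ : ∀ h : H, h * Λ = counit (R := k) h • Λ)
    (lam : H →ₗ[k] k)
    (hlam : ∀ h : H,
      (TensorProduct.lid k H) ((lam.rTensor H) (comul (R := k) h)) = lam h • (1 : H))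
    (hnorm : lam Λ = 1)
    (αH : H →ₗ[k] k)
    (hαH : ∀ L : H, (∀ h : H, h * L = counit (R := k) h • L) →
        ∀ h : H, L * HopfAlgebra.antipode (R := k) h = αH h • L)
    (x : H) (m : M)
    (ι κ : Type) (s : Finset ι) (t : Finset κ)
    (x1 x2 x3 x4 : ι → H) (L1 L2 : κ → H)
    (hx : (LinearMap.lTensor H (LinearMap.lTensor H (comul (R := k))))
            ((LinearMap.lTensor H (comul (R := k))) (comul (R := k) x)) =
          ∑ i ∈ s, x1 i ⊗ₜ[k] (x2 i ⊗ₜ[k] (x3 i ⊗ₜ[k] x4 i)))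
    (hL : comul (R := k) Λ = ∑ j ∈ t, L1 j ⊗ₜ[k] L2 j) :
    ∑ i ∈ s, ∑ j ∈ t,
      (αH (x2 i) *
        lam (HopfAlgebra.antipode (R := k) (x1 i) * L1 j * x3 i)) •
          ((Sinv (L2 j) • m) ⊗ₜ[k] x4 i) = m ⊗ₜ[k] x := by
  classical
  have hSmul : ∀ a b, Sinv (a * b) = Sinv b * Sinv a := by
    intro a b
    rw [← hS2 (Sinv b * Sinv a), HopfAlgebra.antipode_mul_antidistrib, hS1, hS1]
  have hSone : Sinv 1 = 1 := by
    have := hS2 1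
    rwa [HopfAlgebra.antipode_one] at this
  let α : H →ₗ[k] k := αH ∘ₗ Sinv
  have hα : ∀ h : H, Λ * h = α h • Λ := by
    intro h
    have := hαH Λ hΛ (Sinv h)
    rwa [hS1] at this
  have hinj : ∀ c d : k, c • Λ = d • Λ → c = d := fun c d h => smul_left_injective k hΛ0 h
  have hα1 : α 1 = 1 := hinj _ _ (by rw [← hα]; simp)
  have hαm : ∀ a b, α (a * b) = α a * α b := by
    intro a b
    apply hinj
    rw [← hα, ← mul_assoc, hα a, smul_mul_assoc, hα b, smul_smul]
  have hβ : ∀ a, αH a = α (HopfAlgebra.antipode k a) := by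
    intro a; simp [α, hS2]
  let P : H →ₗ[k] H := (TensorProduct.lid k H).toLinearMap ∘ₗ α.rTensor H ∘ₗ comul (R := k)
  let F : H ⊗[k] H →ₗ[k] H := (TensorProduct.lid k H).toLinearMap ∘ₗ TensorProduct.map lam Sinv
  have hFD : F (comul (R := k) Λ) = 1 := by
    have e : F = Sinv ∘ₗ (TensorProduct.lid k H).toLinearMap ∘ₗ lam.rTensor H := by
      ext a b; simp [F]
    rw [e]
    simp [hlam, hnorm, hSone]
  have hFmul : ∀ (a b : H) (u : H ⊗[k] H),
      F (((1 : H) ⊗ₜ[k] a) * u * ((1 : H) ⊗ₜ[k] b)) = Sinv b * F u * Sinv a := by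
    intro a b u
    induction u with
    | zero => simp
    | tmul p q => simp [F, hSmul, mul_assoc]
    | add p q hp hq => simp only [mul_add, add_mul, map_add, hp, hq]
  have hG : ∀ a c : H, F ((HopfAlgebra.antipode k a ⊗ₜ[k] (1 : H)) * comul (R := k) Λ *
      (c ⊗ₜ[k] (1 : H))) = P c * Sinv a := by
    intro a c
    rw [aux_stepA Λ hΛ, mul_assoc, aux_stepB Λ α hα, ← mul_assoc, hFmul, hFD, hS2, mul_one]
    rfl
  have hG' : ∀ a c : H, ∑ j ∈ t, lam (HopfAlgebra.antipode k a * L1 j * c) • Sinv (L2 j) =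
      P c * Sinv a := by
    intro a c
    rw [← hG, hL]
    simp [F, Finset.mul_sum, Finset.sum_mul]
  let act : H →ₗ[k] M := (LinearMap.toSpanSingleton H M m).restrictScalars k
  have hact : ∀ h, act h = h • m := fun h => rfl
  let μ : H ⊗[k] H →ₗ[k] H := (TensorProduct.lid k H).toLinearMap ∘ₗ TensorProduct.map αH P
  have hμ : ∀ y, μ (comul (R := k) y) = y := fun y => aux_stepC α αH hα1 hαm hβ y
  let ν : H ⊗[k] H →ₗ[k] H := LinearMap.mul' k H ∘ₗ (TensorProduct.comm k H H).toLinearMap ∘ₗ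
    Sinv.rTensor H
  have hν : ∀ y, ν (comul (R := k) y) = counit (R := k) y • 1 := by
    intro y
    have e : ∀ u, HopfAlgebra.antipode k (ν u) =
        LinearMap.mul' k H ((HopfAlgebra.antipode k).lTensor H u) := by
      intro u
      induction u with
      | zero => simp
      | tmul p q => simp [ν, HopfAlgebra.antipode_mul_antidistrib, hS1]
      | add p q hp hq => simp only [map_add, hp, hq]
    rw [← hS2 (ν _), e]
    simp [Algebra.algebraMap_eq_smul_one, hSone]
  -- the three-fold map `a ⊗ (b ⊗ d) ↦ (b * Sinv a) • m ⊗ d`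
  let W' : H ⊗[k] (H ⊗[k] H) →ₗ[k] M ⊗[k] H :=
    (act ∘ₗ ν).rTensor H ∘ₗ (TensorProduct.assoc k H H H).symm.toLinearMap
  let W : H ⊗[k] (H ⊗[k] (H ⊗[k] H)) →ₗ[k] M ⊗[k] H :=
    W' ∘ₗ (μ.rTensor H ∘ₗ (TensorProduct.assoc k H H H).symm.toLinearMap).lTensor H
  have hW : ∀ a b c d, W (a ⊗ₜ (b ⊗ₜ (c ⊗ₜ d))) =
      (αH b • ((P c * Sinv a) • m)) ⊗ₜ d := by
    intro a b c d
    simp [W, W', μ, ν, hact]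
  have hL3 : W ((LinearMap.lTensor H (LinearMap.lTensor H (comul (R := k))))
      ((LinearMap.lTensor H (comul (R := k))) (comul (R := k) x))) =
      W' ((LinearMap.lTensor H (comul (R := k))) (comul (R := k) x)) := by
    have e : W ∘ₗ (LinearMap.lTensor H (LinearMap.lTensor H (comul (R := k)))) ∘ₗ
        (LinearMap.lTensor H (comul (R := k))) = W' ∘ₗ LinearMap.lTensor H (comul (R := k)) := by
      have inner : (μ.rTensor H ∘ₗ (TensorProduct.assoc k H H H).symm.toLinearMap) ∘ₗ
          (LinearMap.lTensor H (comul (R := k))) ∘ₗ comul (R := k) = comul (R := k) := by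
        ext y
        simp only [LinearMap.comp_apply, LinearEquiv.coe_coe, Coalgebra.coassoc_symm_apply]
        rw [← LinearMap.rTensor_comp_apply]
        have : μ ∘ₗ comul (R := k) = LinearMap.id := by ext y; exact hμ y
        rw [this]; simp
      simp only [W, LinearMap.comp_assoc]
      rw [← LinearMap.lTensor_comp, ← LinearMap.lTensor_comp, inner]
    exact LinearMap.congr_fun e _
  have hL2 : W' ((LinearMap.lTensor H (comul (R := k))) (comul (R := k) x)) = m ⊗ₜ x := by
    simp only [W', LinearMap.comp_apply, LinearEquiv.coe_coe, Coalgebra.coassoc_symm_apply]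
    rw [← LinearMap.rTensor_comp_apply]
    refine aux_counit_left (((act ∘ₗ ν) ∘ₗ comul (R := k)).rTensor H)
      (TensorProduct.mk k M H m) ?_ x
    intro a b
    simp [hν, hact, TensorProduct.smul_tmul']
  rw [← hL2, ← hL3, hx, map_sum]
  refine Finset.sum_congr rfl fun i _ => ?_
  rw [hW, ← hG', Finset.sum_smul, Finset.smul_sum, TensorProduct.sum_tmul]
  refine Finset.sum_congr rfl fun j _ => ?_
  rw [smul_assoc, smul_smul, TensorProduct.smul_tmul']
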